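/- arXiv:0911.2562 — 2 statements merged into one kernel-verified Lean document; each statement's English description precedes it below -/
import Mathlib

section
/- Let V ⊂ ℂP^M be a smooth complex projective variety of dimension n ≥ 1 and let D_1,…,D_q (q ≥ n+1) be hypersurfaces in ℂP^M with V ⊄ D_j for all j. If condition (i) of the definition of n-subgeneral position holds, i.e. V ∩ D_{j_0} ∩ … ∩ D_{j_n} = ∅ for every 1 ≤ j_0 < … < j_n ≤ q, then condition (ii) holds automatically; consequently D_1,…,D_q are in n-subgeneral position in V if and only if they are in general position in V. -/
open MvPolynomial Filter

noncomputable section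

namespace SMT

/-- The affine cone in `ℂ^K` cut out by an ideal of polynomials
(the common zero set of all its members). -/
def coneOf {K : ℕ} (I : Ideal (MvPolynomial (Fin K) ℂ)) : Set (Fin K → ℂ) :=
  {x | ∀ Q ∈ I, MvPolynomial.eval x Q = 0}

/-- The vanishing ideal of a subset of `ℂ^K`. -/
def vIdeal {K : ℕ} (A : Set (Fin K → ℂ)) : Ideal (MvPolynomial (Fin K) ℂ) where
  carrier := {Q | ∀ x ∈ A, MvPolynomial.eval x Q = 0}
  add_mem' := by
    intro a b ha hb x hx
    simp [ha x hx, hb x hx]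
  zero_mem' := by
    intro x hx
    simp
  smul_mem' := by
    intro c p hp x hx
    simp [smul_eq_mul, hp x hx]

/-- The dimension of (the affine cone over) a subset of `ℂ^K`:
the Krull dimension of its coordinate ring, read off as a natural number. -/
def coneDim {K : ℕ} (A : Set (Fin K → ℂ)) : ℕ :=
  ENat.toNat ((ringKrullDim (MvPolynomial (Fin K) ℂ ⧸ vIdeal A)).unbotD 0)

/-- `I` is the homogeneous (prime) ideal of a complex projective variety of dimension `n`
in `ℂP^{K-1}`: it is prime, generated by homogeneous polynomials, and the affine cone
has Krull dimension `n + 1`. -/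
def IsVariety {K : ℕ} (n : ℕ) (I : Ideal (MvPolynomial (Fin K) ℂ)) : Prop :=
  I.IsPrime ∧
  (∃ S : Set (MvPolynomial (Fin K) ℂ), (∀ Q ∈ S, ∃ e, Q.IsHomogeneous e) ∧ I = Ideal.span S) ∧
  ringKrullDim (MvPolynomial (Fin K) ℂ ⧸ I) = (((n + 1 : ℕ) : ℕ∞) : WithBot ℕ∞)

/-- A smooth complex projective variety of dimension `n` in `ℂP^{K-1}`, presented by its
homogeneous prime ideal: smoothness via the Jacobian criterion at every nonzero point of
the affine cone. -/
def IsSmoothVariety {K : ℕ} (n : ℕ) (I : Ideal (MvPolynomial (Fin K) ℂ)) : Prop :=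
  IsVariety n I ∧
  ∀ x ∈ coneOf I, x ≠ 0 →
    Module.finrank ℂ (Submodule.span ℂ
      {v : Fin K → ℂ | ∃ Q ∈ I, v = fun i => MvPolynomial.eval x (MvPolynomial.pderiv i Q)})
      = K - 1 - n

/-- The affine cone over the hypersurface defined by a homogeneous polynomial. -/
def hypCone {K : ℕ} (Q : MvPolynomial (Fin K) ℂ) : Set (Fin K → ℂ) :=
  {x | MvPolynomial.eval x Q = 0}

/-- The affine cone over `V ∩ (∩_{j ∈ R} D_j)`. -/
def interCone {K q : ℕ} (I : Ideal (MvPolynomial (Fin K) ℂ))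
    (Q : Fin q → MvPolynomial (Fin K) ℂ) (R : Finset (Fin q)) : Set (Fin K → ℂ) :=
  coneOf I ∩ ⋂ j ∈ R, hypCone (Q j)

/-- The codimension function `c(R) = codim_V (V ∩ ∩_{j∈R} D_j)`, with `c(∅) = 0` and
the convention `codim ∅ = n+1` (the cone over the empty projective set is `{0}`,
of cone dimension `0`). -/
def cdim {K q : ℕ} (n : ℕ) (I : Ideal (MvPolynomial (Fin K) ℂ))
    (Q : Fin q → MvPolynomial (Fin K) ℂ) (R : Finset (Fin q)) : ℕ :=
  n + 1 - coneDim (interCone I Q R)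

/-- `ρ(R₁,R₂) = (c(R₂) - c(R₁)) / (#R₂ - #R₁)`. -/
def rho {K q : ℕ} (n : ℕ) (I : Ideal (MvPolynomial (Fin K) ℂ))
    (Q : Fin q → MvPolynomial (Fin K) ℂ) (R₁ R₂ : Finset (Fin q)) : ℝ :=
  ((cdim n I Q R₂ : ℝ) - (cdim n I Q R₁ : ℝ)) / ((R₂.card : ℝ) - (R₁.card : ℝ))

/-- The hypersurfaces `D_j = {Q j = 0}`, `j ∈ S`, are in general position in the
projective variety `V` (of dimension `n`) defined by `I`: any `s` of them (`1 ≤ s ≤ n+1`)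
can be complemented by `n+1-s` further hypersurfaces so that the total intersection with
`V` is empty (in projective space, i.e. the cones meet only in `0`). -/
def GenPos {K q : ℕ} (n : ℕ) (I : Ideal (MvPolynomial (Fin K) ℂ))
    (Q : Fin q → MvPolynomial (Fin K) ℂ) (S : Finset (Fin q)) : Prop :=
  ∀ J : Finset (Fin q), J ⊆ S → 1 ≤ J.card → J.card ≤ n + 1 →
    ∃ Q' : Fin (n + 1 - J.card) → MvPolynomial (Fin K) ℂ,
      (∀ k, ∃ e, 1 ≤ e ∧ (Q' k).IsHomogeneous e) ∧
      ∀ x ∈ interCone I Q J, (∀ k, MvPolynomial.eval x (Q' k) = 0) → x = 0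

/-- A set is algebraic if it is the zero set of its vanishing ideal. -/
def IsAlgSet {K : ℕ} (A : Set (Fin K → ℂ)) : Prop := A = coneOf (vIdeal A)

/-- `σ` is an irreducible component of `S`: an algebraic irreducible subset of `S`,
maximal among such. -/
def IsIrredComponent {K : ℕ} (σ S : Set (Fin K → ℂ)) : Prop :=
  σ ⊆ S ∧ IsAlgSet σ ∧ (vIdeal σ).IsPrime ∧
  ∀ τ : Set (Fin K → ℂ), τ ⊆ S → IsAlgSet τ → (vIdeal τ).IsPrime → σ ⊆ τ → σ = τ

/-- Condition (i) of Definition 1.1: any `N+1` of the hypersurfaces meet `V` in the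
empty (projective) set. -/
def SubgenI {K q : ℕ} (N : ℕ) (I : Ideal (MvPolynomial (Fin K) ℂ))
    (Q : Fin q → MvPolynomial (Fin K) ℂ) : Prop :=
  ∀ J : Finset (Fin q), J.card = N + 1 → ∀ x ∈ interCone I Q J, x = 0

/-- Condition (ii) of Definition 1.1. -/
def SubgenII {K q : ℕ} (n : ℕ) (I : Ideal (MvPolynomial (Fin K) ℂ))
    (Q : Fin q → MvPolynomial (Fin K) ℂ) : Prop :=
  ∀ J : Finset (Fin q), 0 < J.card → J.card ≤ n + 1 → GenPos n I Q J →
    (∃ x ∈ interCone I Q J, x ≠ 0) →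
    ∃ σ : Set (Fin K → ℂ), IsIrredComponent σ (interCone I Q J) ∧
      coneDim σ = coneDim (interCone I Q J) ∧
      ∀ i ∉ J, coneDim (interCone I Q (insert i J)) = coneDim (interCone I Q J) →
        σ ⊆ hypCone (Q i)

/-- The hypersurfaces `D_j = {Q j = 0}` are in `N`-subgeneral position in the projective
variety `V` defined by `I` (Definition 1.1), including the requirement `V ⊄ D_j`. -/
def InSubgenPos {K q : ℕ} (n N : ℕ) (I : Ideal (MvPolynomial (Fin K) ℂ))
    (Q : Fin q → MvPolynomial (Fin K) ℂ) : Prop :=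
  (∀ j, ¬ (coneOf I ⊆ hypCone (Q j))) ∧ SubgenI N I Q ∧ SubgenII n I Q

/-- The Hilbert function `H_X(m) = dim_ℂ ℂ[x]_m / I(m)` of (the variety with homogeneous
ideal) `I`. -/
def hilbert {K : ℕ} (I : Ideal (MvPolynomial (Fin K) ℂ)) (m : ℕ) : ℕ :=
  Module.finrank ℂ
    ((MvPolynomial.homogeneousSubmodule (Fin K) ℂ m) ⧸
      (Submodule.comap (MvPolynomial.homogeneousSubmodule (Fin K) ℂ m).subtype
        (Submodule.restrictScalars ℂ I)))

/-- The degree of an `n`-dimensional projective variety with homogeneous ideal `I`: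
the (unique) natural number `Δ` with `H(m) = Δ·mⁿ/n! + O(m^{n-1})`. -/
def pdeg {K : ℕ} (n : ℕ) (I : Ideal (MvPolynomial (Fin K) ℂ)) : ℕ :=
  sInf {Δ : ℕ | Filter.Tendsto
    (fun m : ℕ => (hilbert I m : ℝ) * (n.factorial : ℝ) / (m : ℝ) ^ n)
    Filter.atTop (nhds (Δ : ℝ))}

/-- The image cone of the cone of `I` under `x ↦ (Q_1(x), …, Q_q(x))`. -/
def imgCone {K q : ℕ} (I : Ideal (MvPolynomial (Fin K) ℂ))
    (Q : Fin q → MvPolynomial (Fin K) ℂ) : Set (Fin q → ℂ) :=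
  (fun x j => MvPolynomial.eval x (Q j)) '' coneOf I

/-! Nevanlinna-theoretic notions. -/

/-- `‖f(z)‖ = max_i |f_i(z)|` for a tuple of functions. -/
def projNorm {ι : Type*} [Fintype ι] (f : ι → ℂ → ℂ) (z : ℂ) : ℝ :=
  ⨆ i, ‖f i z‖

/-- The Nevanlinna characteristic function
`T_f(r) = (2π)⁻¹ ∫_0^{2π} log ‖f(re^{iθ})‖ dθ`. -/
def charFn {ι : Type*} [Fintype ι] (f : ι → ℂ → ℂ) (r : ℝ) : ℝ :=
  (2 * Real.pi)⁻¹ *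
    ∫ θ in (0:ℝ)..(2 * Real.pi),
      Real.log (projNorm f ((r : ℂ) * Complex.exp ((θ : ℂ) * Complex.I)))

/-- The vanishing order of an entire function at a point (the zero divisor). -/
def zeroOrder (φ : ℂ → ℂ) (z : ℂ) : ℕ :=
  sInf {k : ℕ | iteratedDeriv k φ z ≠ 0}

/-- The (unintegrated) counting function `N_φ(r)` of the zero divisor of `φ`. -/
def count (φ : ℂ → ℂ) (r : ℝ) : ℝ :=
  ∫ t in (1:ℝ)..r, (∑ᶠ z ∈ {z : ℂ | ‖z‖ < t}, ((zeroOrder φ z : ℕ) : ℝ)) / t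

/-- The counting function truncated at level `L`. -/
def countTrunc (L : ℕ) (φ : ℂ → ℂ) (r : ℝ) : ℝ :=
  ∫ t in (1:ℝ)..r,
    (∑ᶠ z ∈ {z : ℂ | ‖z‖ < t}, ((min (zeroOrder φ z) L : ℕ) : ℝ)) / t

/-- A tuple of entire functions without common zeros (a reduced representation of a
holomorphic curve in projective space). -/
def ReducedRepr {ι : Type*} [Fintype ι] (f : ι → ℂ → ℂ) : Prop :=
  (∀ i, Differentiable ℂ (f i)) ∧ ∀ z, ∃ i, f i z ≠ 0

/-- The entire function `Q(f_0, …, f_{K-1})`. -/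
def polyComp {K : ℕ} (Q : MvPolynomial (Fin K) ℂ) (f : Fin K → ℂ → ℂ) : ℂ → ℂ :=
  fun z => MvPolynomial.eval (fun i => f i z) Q

/-- The curve with reduced representation `f` has image inside the variety of `I`. -/
def MapsIntoCone {K : ℕ} (f : Fin K → ℂ → ℂ) (I : Ideal (MvPolynomial (Fin K) ℂ)) : Prop :=
  ∀ z, (fun i => f i z) ∈ coneOf I

/-- `f` is an algebraically nondegenerate holomorphic map into the variety of `I`:
its image is contained in `V` but in no proper algebraic subvariety of `V`. -/
def AlgNondeg {K : ℕ} (f : Fin K → ℂ → ℂ) (I : Ideal (MvPolynomial (Fin K) ℂ)) : Prop :=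
  MapsIntoCone f I ∧
  ∀ P : MvPolynomial (Fin K) ℂ, (∃ e, P.IsHomogeneous e) → P ∉ I →
    ∃ z, polyComp P f z ≠ 0

/-- `P r` holds for all `r ∈ [1,∞)` outside a Borel subset `E` of `(1,∞)` of finite
Lebesgue measure. -/
def ExcSMT (P : ℝ → Prop) : Prop :=
  ∃ E : Set ℝ, MeasurableSet E ∧ E ⊆ Set.Ioi 1 ∧ MeasureTheory.volume E < ⊤ ∧
    ∀ r : ℝ, 1 ≤ r → r ∉ E → P r


theorem dim_le_of_integral {R S : Type*} [CommRing R] [CommRing S] (f : R →+* S)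
    (hf : f.IsIntegral) : ringKrullDim S ≤ ringKrullDim R := by
  let _ := f.toAlgebra
  have : Algebra.IsIntegral R S := ⟨hf⟩
  refine Order.krullDim_le_of_strictMono (PrimeSpectrum.comap (algebraMap R S)) ?_
  intro a b hab
  exact Ideal.IsIntegral.comap_lt_comap (R := R) (A := S) (I := a.asIdeal) (J := b.asIdeal) hab

theorem dim_ge_of_integral {R S : Type*} [CommRing R] [CommRing S] (f : R →+* S)
    (hf : f.IsIntegral) (hinj : Function.Injective f) : ringKrullDim R ≤ ringKrullDim S := by
  let _ := f.toAlgebra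
  have : Algebra.IsIntegral R S := ⟨hf⟩
  refine iSup_le fun l => ?_
  obtain ⟨P, -, hP, hPc⟩ := Ideal.exists_ideal_over_prime_of_isIntegral (S := S)
    (RelSeries.head l).asIdeal (⊥ : Ideal S) (by
      have : (⊥ : Ideal S).comap (algebraMap R S) = ⊥ :=
        (RingHom.injective_iff_ker_eq_bot f).1 hinj
      rw [this]; exact bot_le)
  have : P.LiesOver (RelSeries.head l).asIdeal := ⟨hPc.symm⟩
  obtain ⟨L, hL, -, -⟩ := Ideal.exists_ltSeries_of_hasGoingUp (S := S) l P
  rw [← hL]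
  exact le_iSup (fun p : LTSeries (PrimeSpectrum S) => ((p.length : ℕ∞) : WithBot ℕ∞)) L

theorem dim_mvPoly (ι : Type*) [Finite ι] :
    ringKrullDim (MvPolynomial ι ℂ) = ((Nat.card ι : ℕ) : WithBot ℕ∞) := by
  rw [MvPolynomial.ringKrullDim_of_isNoetherianRing, ringKrullDim_eq_zero_of_field, zero_add]

theorem injective_of_integral {ι B : Type*} [Finite ι] [CommRing B] [IsDomain B]
    (f : MvPolynomial ι ℂ →+* B) (hf : f.IsIntegral)
    (hdim : ringKrullDim B = ((Nat.card ι : ℕ) : WithBot ℕ∞)) : Function.Injective f := by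
  rw [injective_iff_map_eq_zero]
  intro r hr
  by_contra hr0
  have h1 : ringKrullDim B ≤
      ringKrullDim (MvPolynomial ι ℂ ⧸ Ideal.span {r}) := by
    refine dim_le_of_integral (Ideal.Quotient.lift (Ideal.span {r}) f ?_) ?_
    · intro a ha
      obtain ⟨c, rfl⟩ := Ideal.mem_span_singleton'.1 ha
      simp [hr]
    · refine RingHom.IsIntegral.tower_top (Ideal.Quotient.mk (Ideal.span {r})) _ ?_
      rwa [Ideal.Quotient.lift_comp_mk]
  have h2 := ringKrullDim_quotient_succ_le_of_nonZeroDivisor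
    (mem_nonZeroDivisors_of_ne_zero hr0)
  rw [dim_mvPoly] at h2
  have h3 : ((Nat.card ι : ℕ) : WithBot ℕ∞) + 1 ≤ ((Nat.card ι : ℕ) : WithBot ℕ∞) :=
    le_trans (by rw [← hdim]; gcongr) h2
  have : Nat.card ι + 1 ≤ Nat.card ι := by exact_mod_cast h3
  omega

theorem lower_prime {ι B : Type*} [Finite ι] [CommRing B]
    (f : MvPolynomial ι ℂ →+* B) (hf : f.IsIntegral) (hinj : Function.Injective f)
    (T : Set ι) : ∃ q : Ideal B, q.IsPrime ∧ (∀ i ∈ T, f (MvPolynomial.X i) ∈ q) ∧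
      ((Nat.card ↥Tᶜ : ℕ) : WithBot ℕ∞) ≤ ringKrullDim (B ⧸ q) := by
  classical
  let κ : MvPolynomial ι ℂ →ₐ[ℂ] MvPolynomial ↥Tᶜ ℂ :=
    MvPolynomial.aeval (fun i => if h : i ∈ Tᶜ then MvPolynomial.X ⟨i, h⟩ else 0)
  let r : MvPolynomial ↥Tᶜ ℂ →ₐ[ℂ] MvPolynomial ι ℂ := MvPolynomial.rename Subtype.val
  have hκr : ∀ p, κ (r p) = p := by
    intro p
    have : κ.comp r = AlgHom.id ℂ _ := by
      ext i : 1
      have hi : (i : ι) ∉ T := i.2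
      simp [κ, r, hi]
    exact congrArg (fun g => g p) this
  let _ := f.toAlgebra
  have : Algebra.IsIntegral (MvPolynomial ι ℂ) B := ⟨hf⟩
  have : (RingHom.ker κ).IsPrime := RingHom.ker_isPrime _
  obtain ⟨q, -, hq, hqc⟩ := Ideal.exists_ideal_over_prime_of_isIntegral (S := B)
    (RingHom.ker κ) (⊥ : Ideal B) (by
      have : (⊥ : Ideal B).comap (algebraMap (MvPolynomial ι ℂ) B) = ⊥ :=
        (RingHom.injective_iff_ker_eq_bot f).1 hinj
      rw [this]; exact bot_le)
  have hmem : ∀ p, f p ∈ q ↔ κ p = 0 := by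
    intro p
    rw [← RingHom.mem_ker, ← hqc]; rfl
  refine ⟨q, hq, ?_, ?_⟩
  · intro i hi
    rw [hmem]
    simp [κ, hi]
  · rw [← dim_mvPoly]
    have hcomp : (((Ideal.Quotient.mk q).comp f).comp (r : MvPolynomial ↥Tᶜ ℂ →+* _)).comp
        (κ : MvPolynomial ι ℂ →+* _) = (Ideal.Quotient.mk q).comp f := by
      refine RingHom.ext fun p => ?_
      change Ideal.Quotient.mk q (f (r (κ p))) = Ideal.Quotient.mk q (f p)
      rw [Ideal.Quotient.eq, ← map_sub, hmem, map_sub, hκr, sub_self]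
    refine dim_ge_of_integral (((Ideal.Quotient.mk q).comp f).comp (r : MvPolynomial ↥Tᶜ ℂ →+* _)) ?_ ?_
    · refine RingHom.IsIntegral.tower_top (κ : MvPolynomial ι ℂ →+* _) _ ?_
      rw [hcomp]
      exact hf.trans _ _ (RingHom.isIntegral_of_surjective _ Ideal.Quotient.mk_surjective)
    · rw [injective_iff_map_eq_zero]
      intro p hp
      have hp' : Ideal.Quotient.mk q (f (r p)) = 0 := hp
      rw [Ideal.Quotient.eq_zero_iff_mem, hmem, hκr] at hp'
      exact hp'

attribute [local instance] MvPolynomial.gradedAlgebra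

theorem comp_mul {K : ℕ} (h F : MvPolynomial (Fin K) ℂ) (d e : ℕ) (hF : F.IsHomogeneous d) :
    homogeneousComponent e (h * F) =
      if d ≤ e then homogeneousComponent (e - d) h * F else 0 := by
  have h1 := DirectSum.coe_decompose_mul_of_right_mem
    (MvPolynomial.homogeneousSubmodule (Fin K) ℂ) (a := h) (b := F) (i := d) e hF
  have h2 : ∀ (φ : MvPolynomial (Fin K) ℂ) i,
    (DirectSum.decompose (MvPolynomial.homogeneousSubmodule (Fin K) ℂ) φ i : MvPolynomial (Fin K) ℂ)
      = homogeneousComponent i φ := fun φ i => MvPolynomial.decomposition.decompose'_apply φ i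
  rw [h2, h2] at h1
  exact h1

theorem integral_key {K : ℕ} {ι B : Type*} [Fintype ι] [CommRing B]
    (I : Ideal (MvPolynomial (Fin K) ℂ))
    (π : MvPolynomial (Fin K) ℂ →+* B) (hπ : Function.Surjective π) (hker : ∀ u ∈ I, π u = 0)
    (hI : I.IsHomogeneous (homogeneousSubmodule (Fin K) ℂ))
    (F : ι → MvPolynomial (Fin K) ℂ) (d : ι → ℕ) (hd : ∀ i, 1 ≤ d i)
    (hF : ∀ i, (F i).IsHomogeneous (d i))
    (hz : ∀ x ∈ coneOf I, (∀ i, MvPolynomial.eval x (F i) = 0) → x = 0) :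
    (π.comp
      (MvPolynomial.aeval F : MvPolynomial ι ℂ →ₐ[ℂ] MvPolynomial (Fin K) ℂ).toRingHom).IsIntegral := by
  set f := (π.comp
      (MvPolynomial.aeval F : MvPolynomial ι ℂ →ₐ[ℂ] MvPolynomial (Fin K) ℂ).toRingHom) with hf
  have hfX : ∀ i, f (X i) = π (F i) := by intro i; simp [hf]
  have hfC : ∀ c, f (C c) = π (C c) := by intro i; simp [hf, MvPolynomial.algebraMap_eq]
  have hrad : idealOfVars (Fin K) ℂ ≤ (I ⊔ Ideal.span (Set.range F)).radical := by
    rw [← MvPolynomial.vanishingIdeal_zeroLocus_eq_radical (K := ℂ)]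
    rw [idealOfVars, Ideal.span_le]
    rintro _ ⟨i, rfl⟩
    rw [SetLike.mem_coe, mem_vanishingIdeal_iff]
    intro x hx
    have : x = 0 := by
      apply hz
      · intro Q hQ
        have := hx Q (Ideal.mem_sup_left hQ)
        simpa [aeval_eq_eval] using this
      · intro i
        have := hx (F i) (Ideal.mem_sup_right (Ideal.subset_span ⟨i, rfl⟩))
        simpa [aeval_eq_eval] using this
    simp [this]
  obtain ⟨N, hN⟩ := Ideal.exists_pow_le_of_le_radical_of_fg hrad (IsNoetherian.noetherian _)
  let _ := f.toAlgebra
  have hsm : ∀ p b, p • b = f p * b := fun p b => rfl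
  let G : Set (B) :=
    (fun a => π (monomial a (1:ℂ))) '' {a | Finsupp.degree a < N}
  have hG : G.Finite := (Finsupp.finite_of_degree_lt N).image _
  have key : ∀ e : ℕ, ∀ g : MvPolynomial (Fin K) ℂ, g.IsHomogeneous e →
      π g ∈ Submodule.span (MvPolynomial ι ℂ) G := by
    intro e
    induction e using Nat.strong_induction_on with
    | _ e ih =>
    intro g hg
    by_cases heN : e < N
    · rw [g.as_sum, map_sum]
      refine Submodule.sum_mem _ fun a ha => ?_
      have hdeg : Finsupp.degree a = e := by
        have := hg (mem_support_iff.1 ha)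
        rwa [Finsupp.degree_eq_weight_one]
      have : π (monomial a (coeff a g)) =
          (C (coeff a g) : MvPolynomial ι ℂ) • π (monomial a (1:ℂ)) := by
        rw [hsm, hfC, ← map_mul, C_mul_monomial, mul_one]
      rw [this]
      exact Submodule.smul_mem _ _ (Submodule.subset_span ⟨a, by simpa [hdeg] using heN, rfl⟩)
    · have hgm : g ∈ I ⊔ Ideal.span (Set.range F) := by
        apply hN
        rw [mem_pow_idealOfVars_iff]
        intro a ha
        have := hg (mem_support_iff.1 ha)
        have hh : Finsupp.degree a = e := by rwa [Finsupp.degree_eq_weight_one]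
        omega
      obtain ⟨u, hu, v, hv, huv⟩ := Submodule.mem_sup.1 hgm
      obtain ⟨c, rfl⟩ := Ideal.mem_span_range_iff_exists_fun.1 hv
      have hge : g = homogeneousComponent e u +
          ∑ i, homogeneousComponent e (c i * F i) := by
        rw [← map_sum, ← map_add, huv]
        exact (homogeneousComponent_of_mem hg).symm ▸ by simp
      rw [hge, map_add, map_sum]
      refine Submodule.add_mem _ ?_ (Submodule.sum_mem _ fun i _ => ?_)
      · rw [hker]
        · exact Submodule.zero_mem _
        · exact (mem_iff_homogeneousComponent_mem hI u).1 hu e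
      · rw [comp_mul _ _ _ _ (hF i)]
        split_ifs with hde
        · have := ih (e - d i) (by have := hd i; omega) _
            (homogeneousComponent_isHomogeneous (e - d i) (c i))
          have h2 := Submodule.smul_mem _ (X i : MvPolynomial ι ℂ) this
          rw [hsm, hfX, ← map_mul, mul_comm] at h2
          exact h2
        · simp
  have hfin : Module.Finite (MvPolynomial ι ℂ) (B) := by
    refine ⟨Submodule.fg_def.2 ⟨G, hG, ?_⟩⟩
    rw [eq_top_iff]
    rintro b -
    obtain ⟨g, rfl⟩ := hπ b
    rw [← sum_homogeneousComponent g, map_sum]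
    exact Submodule.sum_mem _ fun i _ => key i _ (homogeneousComponent_isHomogeneous i g)
  have := Algebra.IsIntegral.of_finite (MvPolynomial ι ℂ) (B)
  exact this.isIntegral

theorem upper_dim {ι B : Type*} [Finite ι] [CommRing B]
    (f : MvPolynomial ι ℂ →+* B) (hf : f.IsIntegral)
    (T : Set ι) (hT : ∀ i ∈ T, f (MvPolynomial.X i) = 0) :
    ringKrullDim B ≤ ((Nat.card ↥Tᶜ : ℕ) : WithBot ℕ∞) := by
  classical
  let κ : MvPolynomial ι ℂ →ₐ[ℂ] MvPolynomial ↥Tᶜ ℂ :=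
    MvPolynomial.aeval (fun i => if h : i ∈ Tᶜ then MvPolynomial.X ⟨i, h⟩ else 0)
  let r : MvPolynomial ↥Tᶜ ℂ →ₐ[ℂ] MvPolynomial ι ℂ := MvPolynomial.rename Subtype.val
  have hcomp : (f.comp (r : MvPolynomial ↥Tᶜ ℂ →+* _)).comp
        (κ : MvPolynomial ι ℂ →+* _) = f := by
    refine MvPolynomial.ringHom_ext ?_ ?_
    · intro c
      have : r (κ (C c)) = C c := by
        simp [κ, r, MvPolynomial.algebraMap_eq]
      exact congrArg f this
    · intro i
      change f (r (κ (X i))) = f (X i)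
      by_cases hi : i ∈ T
      · simp [κ, hi, hT i hi]
      · simp [κ, r, hi]
  rw [← dim_mvPoly]
  refine dim_le_of_integral (f.comp (r : MvPolynomial ↥Tᶜ ℂ →+* _)) ?_
  refine RingHom.IsIntegral.tower_top (κ : MvPolynomial ι ℂ →+* _) _ ?_
  rw [hcomp]
  exact hf

theorem vIdeal_coneOf {K : ℕ} (p : Ideal (MvPolynomial (Fin K) ℂ)) (hp : p.IsPrime) :
    vIdeal (coneOf p) = p := by
  have h := MvPolynomial.IsPrime.vanishingIdeal_zeroLocus (K := ℂ) p
  have h2 : vIdeal (coneOf p) = vanishingIdeal ℂ (zeroLocus ℂ p) := by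
    ext u
    rw [mem_vanishingIdeal_iff]
    simp only [MvPolynomial.aeval_eq_eval]
    rfl
  rw [h2, h]

theorem mem_interCone {K q : ℕ} (I : Ideal (MvPolynomial (Fin K) ℂ))
    (Q : Fin q → MvPolynomial (Fin K) ℂ) (R : Finset (Fin q)) (x : Fin K → ℂ) :
    x ∈ interCone I Q R ↔ x ∈ coneOf I ∧ ∀ j ∈ R, MvPolynomial.eval x (Q j) = 0 := by
  simp [interCone, hypCone]

theorem main_dim {K n q : ℕ} (I : Ideal (MvPolynomial (Fin K) ℂ)) (hV : IsVariety n I)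
    (Q : Fin q → MvPolynomial (Fin K) ℂ) (d : Fin q → ℕ)
    (hd : ∀ j, 1 ≤ d j) (hQ : ∀ j, (Q j).IsHomogeneous (d j))
    (J' R : Finset (Fin q)) (hJ' : J'.card = n + 1) (hR : R ⊆ J')
    (hz : ∀ x ∈ interCone I Q J', x = 0) :
    ringKrullDim (MvPolynomial (Fin K) ℂ ⧸ vIdeal (interCone I Q R)) ≤
      ((n + 1 - R.card : ℕ) : WithBot ℕ∞) ∧
    ∃ p : Ideal (MvPolynomial (Fin K) ℂ), p.IsPrime ∧ vIdeal (interCone I Q R) ≤ p ∧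
      ((n + 1 - R.card : ℕ) : WithBot ℕ∞) ≤ ringKrullDim (MvPolynomial (Fin K) ℂ ⧸ p) := by
  classical
  obtain ⟨hprime, ⟨S, hS, hIS⟩, hdim⟩ := hV
  have hhom : I.IsHomogeneous (homogeneousSubmodule (Fin K) ℂ) := by
    rw [hIS]
    exact Ideal.homogeneous_span _ _ fun x hx => hS x hx
  let T : Set ↥J' := {j | (j : Fin q) ∈ R}
  have hT : Nat.card ↥Tᶜ = n + 1 - R.card := by
    have e : ↥Tᶜ ≃ ↥(J' \ R) :=
      { toFun := fun j => ⟨j.1.1, Finset.mem_sdiff.2 ⟨j.1.2, j.2⟩⟩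
        invFun := fun j => ⟨⟨j.1, (Finset.mem_sdiff.1 j.2).1⟩, (Finset.mem_sdiff.1 j.2).2⟩
        left_inv := fun _ => rfl
        right_inv := fun _ => rfl }
    rw [Nat.card_congr e, Nat.card_eq_fintype_card, Fintype.card_coe,
      Finset.card_sdiff_of_subset hR, hJ']
  have hcard : Nat.card ↥J' = n + 1 := by
    rw [Nat.card_eq_fintype_card, Fintype.card_coe, hJ']
  have hz' : ∀ x ∈ coneOf I, (∀ j : ↥J', MvPolynomial.eval x (Q j) = 0) → x = 0 :=
    fun x hx h => hz x ((mem_interCone _ _ _ _).2 ⟨hx, fun j hj => h ⟨j, hj⟩⟩)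
  have hIL : I ≤ vIdeal (interCone I Q R) := fun u hu x hx =>
    ((mem_interCone _ _ _ _).1 hx).1 u hu
  have hQL : ∀ j ∈ R, Q j ∈ vIdeal (interCone I Q R) := fun j hj x hx =>
    ((mem_interCone _ _ _ _).1 hx).2 j hj
  rw [← hT]
  constructor
  · have hIntegral := integral_key I (Ideal.Quotient.mk (vIdeal (interCone I Q R)))
      Ideal.Quotient.mk_surjective (fun u hu => Ideal.Quotient.eq_zero_iff_mem.2 (hIL hu)) hhom
      (fun j : ↥J' => Q j) (fun j => d j) (fun j => hd j) (fun j => hQ j) hz'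
    refine upper_dim _ hIntegral T ?_
    intro j hj
    simpa using Ideal.Quotient.eq_zero_iff_mem.2 (hQL j hj)
  · have hIntegral := integral_key I (Ideal.Quotient.mk I)
      Ideal.Quotient.mk_surjective (fun u hu => Ideal.Quotient.eq_zero_iff_mem.2 hu) hhom
      (fun j : ↥J' => Q j) (fun j => d j) (fun j => hd j) (fun j => hQ j) hz'
    have hinj := injective_of_integral _ hIntegral (by rw [hdim, hcard]; rfl)
    obtain ⟨p, hp, hpT, hpd⟩ := lower_prime _ hIntegral hinj T
    refine ⟨p.comap (Ideal.Quotient.mk I), Ideal.comap_isPrime _ _, ?_, ?_⟩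
    · have hcp : (p.comap (Ideal.Quotient.mk I)).IsPrime := Ideal.comap_isPrime _ _
      intro u hu
      rw [← vIdeal_coneOf _ hcp]
      intro x hx
      apply hu
      rw [mem_interCone]
      refine ⟨fun v hv => hx v ?_, fun j hj => hx (Q j) ?_⟩
      · rw [Ideal.mem_comap, Ideal.Quotient.eq_zero_iff_mem.2 hv]
        exact p.zero_mem
      · have := hpT ⟨j, hR hj⟩ hj
        simpa using this
    · refine hpd.trans (ringKrullDim_le_of_surjective
        (Ideal.Quotient.lift (p.comap (Ideal.Quotient.mk I))
          ((Ideal.Quotient.mk p).comp (Ideal.Quotient.mk I)) ?_) ?_)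
      · intro a ha
        exact Ideal.Quotient.eq_zero_iff_mem.2 ha
      · exact Ideal.Quotient.lift_surjective_of_surjective _ _
          (Ideal.Quotient.mk_surjective.comp Ideal.Quotient.mk_surjective)

theorem coneDim_of {K m : ℕ} (A : Set (Fin K → ℂ))
    (h : ringKrullDim (MvPolynomial (Fin K) ℂ ⧸ vIdeal A) = ((m : ℕ) : WithBot ℕ∞)) :
    coneDim A = m := by
  rw [coneDim, h]
  rfl

theorem dim_quot_anti {A : Type*} [CommRing A] {a b : Ideal A} (h : a ≤ b) :
    ringKrullDim (A ⧸ b) ≤ ringKrullDim (A ⧸ a) :=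
  ringKrullDim_le_of_surjective (Ideal.Quotient.factor h) (Ideal.Quotient.factor_surjective h)

theorem coneDim_inter {K n q : ℕ} (I : Ideal (MvPolynomial (Fin K) ℂ)) (hV : IsVariety n I)
    (Q : Fin q → MvPolynomial (Fin K) ℂ) (d : Fin q → ℕ)
    (hd : ∀ j, 1 ≤ d j) (hQ : ∀ j, (Q j).IsHomogeneous (d j)) (hq : n + 1 ≤ q)
    (hI : SubgenI n I Q) (R : Finset (Fin q)) (hR : R.card ≤ n + 1) :
    coneDim (interCone I Q R) = n + 1 - R.card ∧
    ∃ σ, IsIrredComponent σ (interCone I Q R) ∧ coneDim σ = n + 1 - R.card := by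
  obtain ⟨J', hRJ', hJ'⟩ := Finset.exists_superset_card_eq hR (by simpa using hq)
  obtain ⟨h1, p₀, hp₀, hLp₀, h2⟩ := main_dim I hV Q d hd hQ J' R hJ' hRJ' (hI J' hJ')
  obtain ⟨p, hp, hpp₀⟩ := Ideal.exists_minimalPrimes_le hLp₀
  have hpp : p.IsPrime := hp.1.1
  have hLp : vIdeal (interCone I Q R) ≤ p := hp.1.2
  have e1 := dim_quot_anti hLp
  have e2 := dim_quot_anti hpp₀
  refine ⟨coneDim_of _ (le_antisymm h1 (h2.trans (e2.trans e1))), coneOf p,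
    ⟨?_, ?_, ?_, ?_⟩, coneDim_of _ ?_⟩
  · intro x hx
    rw [mem_interCone]
    refine ⟨fun u hu => hx u (hLp ?_), fun j hj => hx (Q j) (hLp ?_)⟩
    · intro y hy
      exact ((mem_interCone _ _ _ _).1 hy).1 u hu
    · intro y hy
      exact ((mem_interCone _ _ _ _).1 hy).2 j hj
  · rw [IsAlgSet, vIdeal_coneOf p hpp]
  · rw [vIdeal_coneOf p hpp]; exact hpp
  · intro τ hτS hτ hτp hστ
    have h3 : vIdeal τ ≤ p := by
      rw [← vIdeal_coneOf p hpp]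
      exact fun u hu x hx => hu x (hστ hx)
    have h4 : vIdeal (interCone I Q R) ≤ vIdeal τ := fun u hu x hx => hu x (hτS hx)
    have h5 : p ≤ vIdeal τ := hp.2 ⟨hτp, h4⟩ h3
    rw [hτ, le_antisymm h3 h5]
  · rw [vIdeal_coneOf p hpp]
    exact le_antisymm (e1.trans h1) (h2.trans e2)

/-- For `N = n`, condition (i) of the definition of `n`-subgeneral position implies
condition (ii); consequently `D_1, …, D_q` are in `n`-subgeneral position in `V` if and
only if they are in general position in `V`. -/
theorem statement5 {M n q : ℕ} (hn : 1 ≤ n)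
    (I : Ideal (MvPolynomial (Fin (M + 1)) ℂ)) (hV : IsSmoothVariety n I)
    (Q : Fin q → MvPolynomial (Fin (M + 1)) ℂ) (d : Fin q → ℕ)
    (hd : ∀ j, 1 ≤ d j) (hQ : ∀ j, (Q j).IsHomogeneous (d j))
    (hVD : ∀ j, ¬ (coneOf I ⊆ hypCone (Q j))) (hq : n + 1 ≤ q) :
    (SubgenI n I Q → SubgenII n I Q) ∧
      (InSubgenPos n n I Q ↔ GenPos n I Q Finset.univ) := by
  have part1 : SubgenI n I Q → SubgenII n I Q := by
    intro hI J hJ0 hJn _ ⟨x, hx, hx0⟩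
    have hJlt : J.card ≤ n := by
      by_contra hcon
      exact hx0 (hI J (by omega) x hx)
    obtain ⟨hJd, σ, hσ, hσd⟩ := coneDim_inter I hV.1 Q d hd hQ hq hI J hJn
    refine ⟨σ, hσ, hσd.trans hJd.symm, ?_⟩
    intro i hi heq
    have hc : (insert i J).card = J.card + 1 := Finset.card_insert_of_notMem hi
    obtain ⟨hd', -⟩ := coneDim_inter I hV.1 Q d hd hQ hq hI (insert i J) (by omega)
    omega
  refine ⟨part1, ?_, ?_⟩
  · rintro ⟨-, hI, -⟩ J - hJ1 hJn
    obtain ⟨J', hJJ', hJ'⟩ := Finset.exists_superset_card_eq hJn (by simpa using hq)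
    have hc : (J' \ J).card = n + 1 - J.card := by
      rw [Finset.card_sdiff_of_subset hJJ', hJ']
    let e := (J' \ J).equivFinOfCardEq hc
    refine ⟨fun k => Q (e.symm k), fun k => ⟨d (e.symm k), hd _, hQ _⟩, ?_⟩
    intro x hx hk
    apply hI J' hJ'
    rw [mem_interCone] at hx ⊢
    refine ⟨hx.1, fun j hj => ?_⟩
    by_cases hjJ : j ∈ J
    · exact hx.2 j hjJ
    · have := hk (e ⟨j, Finset.mem_sdiff.2 ⟨hj, hjJ⟩⟩)
      simpa using this
  · intro hG
    have hI : SubgenI n I Q := by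
      intro J hJ x hx
      obtain ⟨Q', -, h⟩ := hG J (Finset.subset_univ _) (by omega) (by omega)
      exact h x hx fun k => absurd k.2 (by omega)
    exact ⟨hVD, hI, part1 hI⟩

end SMT
end
end

section
/- Let D_1,…,D_q be hypersurfaces in ℂP^M in N-subgeneral position in a smooth projective variety V ⊂ ℂP^M of dimension n (N ≥ n, q ≥ N+1), with codimension function c on subsets of Q = {1,…,q}. Then for any S_1 ⊆ S_2 ⊆ Q one has #S_1 − c(S_1) ≤ #S_2 − c(S_2); moreover, if #S_2 ≤ N+1 then #S_2 − c(S_2) ≤ N − n. -/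
open MvPolynomial Filter

noncomputable section

namespace SMT

attribute [local instance] MvPolynomial.gradedAlgebra

lemma eval_zero_of_homog {K e : ℕ} {f : MvPolynomial (Fin K) ℂ} (hf : f.IsHomogeneous e)
    (he : e ≠ 0) : MvPolynomial.eval (0 : Fin K → ℂ) f = 0 := by
  have h := hf.coeff_eq_zero (d := 0) (by simpa using he.symm)
  simpa [MvPolynomial.constantCoeff_eq] using h

/-- Every maximal ideal of a polynomial ring in `s` variables has height at least `s`. -/
lemma le_height_of_isMaximal (s : ℕ) (P : Ideal (MvPolynomial (Fin s) ℂ)) [hP : P.IsMaximal] :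
    (s : ℕ∞) ≤ P.height := by
  induction s with
  | zero => simp
  | succ s ih =>
    let e := (MvPolynomial.finSuccEquiv ℂ s).toRingEquiv
    have hM : (P.map e).IsMaximal := Ideal.map_isMaximal_of_equiv e
    rw [← e.height_map P]
    set P' := P.map e with hP'
    have : (P'.comap (Polynomial.C : MvPolynomial (Fin s) ℂ →+* _)).IsMaximal :=
      Polynomial.isMaximal_comap_C_of_isJacobsonRing P'
    have h := ih (P'.comap (Polynomial.C : MvPolynomial (Fin s) ℂ →+* _))
    have hl : P'.LiesOver (P'.comap (Polynomial.C : MvPolynomial (Fin s) ℂ →+* _)) := ⟨rfl⟩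
    rw [Polynomial.height_eq_height_add_one
      (P'.comap (Polynomial.C : MvPolynomial (Fin s) ℂ →+* _)) P']
    push_cast
    gcongr

/-- In an affine domain over `ℂ` every maximal ideal has height at least the dimension. -/
lemma ringKrullDim_le_height {A : Type} [CommRing A] [IsDomain A] [Algebra ℂ A]
    [Algebra.FiniteType ℂ A] (m : Ideal A) [hm : m.IsMaximal] :
    ringKrullDim A ≤ (m.height : WithBot ℕ∞) := by
  obtain ⟨s, g, hinj, hint⟩ := exists_integral_inj_algHom_of_fg ℂ A
  algebraize [g.toRingHom]
  have hnoeth : IsNoetherianRing A := Algebra.FiniteType.isNoetherianRing ℂ A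
  have hi : Algebra.IsIntegral (MvPolynomial (Fin s) ℂ) A := ⟨hint⟩
  have hf : FaithfulSMul (MvPolynomial (Fin s) ℂ) A :=
    (faithfulSMul_iff_algebraMap_injective _ _).2 hinj
  have h1 : ringKrullDim A ≤ ringKrullDim (MvPolynomial (Fin s) ℂ) := by
    refine Order.krullDim_le_of_strictMono
      (PrimeSpectrum.comap (algebraMap (MvPolynomial (Fin s) ℂ) A)) ?_
    intro p q hpq
    exact Ideal.IsIntegral.comap_lt_comap hpq
  have h2 : ringKrullDim (MvPolynomial (Fin s) ℂ) = ((s : ℕ∞) : WithBot ℕ∞) := by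
    simp
  have hmax : (m.under (MvPolynomial (Fin s) ℂ)).IsMaximal :=
    Ideal.isMaximal_comap_of_isIntegral_of_isMaximal m
  have h3 := le_height_of_isMaximal s (m.under (MvPolynomial (Fin s) ℂ))
  have h4 := Ideal.height_eq_height_add_of_liesOver_of_hasGoingDown
    (m.under (MvPolynomial (Fin s) ℂ)) m
  rw [h2] at h1
  refine h1.trans ?_
  norm_cast
  rw [h4]
  exact h3.trans le_self_add

/-- Cutting an irreducible affine variety by a hypersurface through one of its points drops the
dimension by at most one. -/
lemma dim_prime {K : ℕ} (P : Ideal (MvPolynomial (Fin K) ℂ)) [P.IsPrime]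
    (m : Ideal (MvPolynomial (Fin K) ℂ)) [hm : m.IsMaximal] (hPm : P ≤ m)
    (f : MvPolynomial (Fin K) ℂ) (hf : f ∈ m) :
    ringKrullDim (MvPolynomial (Fin K) ℂ ⧸ P) ≤
      ringKrullDim (MvPolynomial (Fin K) ℂ ⧸ (P ⊔ Ideal.span {f})) + 1 := by
  have hmax : (m.map (Ideal.Quotient.mk P)).IsMaximal :=
    .map_of_surjective_of_ker_le Ideal.Quotient.mk_surjective (by simpa using hPm)
  have h1 := ringKrullDim_le_height (m.map (Ideal.Quotient.mk P))
  have h2 := Ideal.height_le_ringKrullDim_quotient_add_one (p := m.map (Ideal.Quotient.mk P))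
    (Ideal.mem_map_of_mem (Ideal.Quotient.mk P) hf)
  refine h1.trans (h2.trans ?_)
  gcongr
  have e := DoubleQuot.quotQuotEquivQuotSup P (Ideal.span {f})
  rw [Ideal.map_span, Set.image_singleton] at e
  exact (ringKrullDim_eq_of_ringEquiv e).le

lemma dim_homog {K : ℕ} (J : Ideal (MvPolynomial (Fin K) ℂ))
    (hJ : J.IsHomogeneous (MvPolynomial.homogeneousSubmodule (Fin K) ℂ))
    (f : MvPolynomial (Fin K) ℂ) (hf : MvPolynomial.eval 0 f = 0) :
    ringKrullDim (MvPolynomial (Fin K) ℂ ⧸ J) ≤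
      ringKrullDim (MvPolynomial (Fin K) ℂ ⧸ (J ⊔ Ideal.span {f})) + 1 := by
  rw [ringKrullDim_quotient J]
  refine iSup_le fun p => ?_
  obtain ⟨P, hPmin, hPle⟩ := Ideal.exists_minimalPrimes_le (show J ≤ p.head.1.asIdeal from p.head.2)
  have hPprime : P.IsPrime := hPmin.1.1
  -- `P` is homogeneous
  have hPh : P.IsHomogeneous (MvPolynomial.homogeneousSubmodule (Fin K) ℂ) := by
    have hc : (P.homogeneousCore (MvPolynomial.homogeneousSubmodule (Fin K) ℂ)).toIdeal.IsPrime :=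
      Ideal.IsPrime.homogeneousCore hPprime
    have hle : J ≤ (P.homogeneousCore (MvPolynomial.homogeneousSubmodule (Fin K) ℂ)).toIdeal := by
      rw [← hJ.toIdeal_homogeneousCore_eq_self]
      exact Ideal.homogeneousCore_mono _ hPmin.1.2
    have h1 := hPmin.2 ⟨hc, hle⟩ (Ideal.toIdeal_homogeneousCore_le _ _)
    have h2 : (P.homogeneousCore (MvPolynomial.homogeneousSubmodule (Fin K) ℂ)).toIdeal = P :=
      le_antisymm (Ideal.toIdeal_homogeneousCore_le _ _) h1
    rw [← h2]
    exact HomogeneousIdeal.isHomogeneous _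
  have hm : (MvPolynomial.vanishingIdeal ℂ {(0 : Fin K → ℂ)}).IsMaximal := inferInstance
  have hPm : P ≤ MvPolynomial.vanishingIdeal ℂ {(0 : Fin K → ℂ)} := by
    intro g hg
    rw [MvPolynomial.mem_vanishingIdeal_singleton_iff]
    have h0 := MvPolynomial.homogeneousComponent_mem_of_mem hPh hg 0
    rw [MvPolynomial.homogeneousComponent_zero] at h0
    by_contra hne
    apply hPprime.ne_top
    refine Ideal.eq_top_of_isUnit_mem P h0 ?_
    refine IsUnit.map _ (isUnit_iff_ne_zero.2 ?_)
    simpa [MvPolynomial.constantCoeff_eq] using hne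
  have h1 := dim_prime P _ hPm f (by
    rw [MvPolynomial.mem_vanishingIdeal_singleton_iff]
    simpa [MvPolynomial.aeval_eq_eval] using hf)
  have h2 : ((p.length : ℕ∞) : WithBot ℕ∞) ≤ ringKrullDim (MvPolynomial (Fin K) ℂ ⧸ P) := by
    rw [ringKrullDim_quotient P]
    let p' : LTSeries (PrimeSpectrum.zeroLocus (P : Set (MvPolynomial (Fin K) ℂ))) :=
      { length := p.length
        toFun := fun i => ⟨(p i).1, hPle.trans (LTSeries.head_le p i)⟩
        step := fun i => p.step i }
    exact Order.LTSeries.length_le_krullDim p'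
  refine le_trans ?_ (h2.trans (h1.trans ?_))
  · exact le_rfl
  · gcongr
    exact ringKrullDim_le_of_surjective (Ideal.Quotient.factor
      (sup_le_sup_right hPmin.1.2 (Ideal.span {f}))) (Ideal.Quotient.factor_surjective _)

/-- The ideal generated by `I` and the `Q j`, `j ∈ R`. -/
def jIdeal {K q : ℕ} (I : Ideal (MvPolynomial (Fin K) ℂ))
    (Q : Fin q → MvPolynomial (Fin K) ℂ) (R : Finset (Fin q)) : Ideal (MvPolynomial (Fin K) ℂ) :=
  I ⊔ Ideal.span (Q '' R)

lemma interCone_eq {K q : ℕ} (I : Ideal (MvPolynomial (Fin K) ℂ))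
    (Q : Fin q → MvPolynomial (Fin K) ℂ) (R : Finset (Fin q)) :
    interCone I Q R = MvPolynomial.zeroLocus ℂ (jIdeal I Q R) := by
  ext x
  have : x ∈ MvPolynomial.zeroLocus ℂ (jIdeal I Q R) ↔
      jIdeal I Q R ≤ MvPolynomial.vanishingIdeal ℂ {x} := by
    rw [← MvPolynomial.le_zeroLocus_iff_le_vanishingIdeal]; simp
  rw [this, jIdeal, sup_le_iff, Ideal.span_le]
  simp [interCone, coneOf, hypCone, SetLike.le_def, Set.subset_def,
    MvPolynomial.aeval_eq_eval]

lemma vIdeal_interCone {K q : ℕ} (I : Ideal (MvPolynomial (Fin K) ℂ))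
    (Q : Fin q → MvPolynomial (Fin K) ℂ) (R : Finset (Fin q)) :
    vIdeal (interCone I Q R) = (jIdeal I Q R).radical := by
  rw [← MvPolynomial.vanishingIdeal_zeroLocus_eq_radical (K := ℂ), ← interCone_eq]
  ext p
  simp only [MvPolynomial.mem_vanishingIdeal_iff, MvPolynomial.aeval_eq_eval]
  rfl

lemma dim_vIdeal {K q : ℕ} (I : Ideal (MvPolynomial (Fin K) ℂ))
    (Q : Fin q → MvPolynomial (Fin K) ℂ) (R : Finset (Fin q)) :
    ringKrullDim (MvPolynomial (Fin K) ℂ ⧸ vIdeal (interCone I Q R)) =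
      ringKrullDim (MvPolynomial (Fin K) ℂ ⧸ jIdeal I Q R) := by
  rw [vIdeal_interCone, ringKrullDim_quotient, ringKrullDim_quotient,
    PrimeSpectrum.zeroLocus_radical]

lemma zero_mem_interCone {K q n : ℕ} (I : Ideal (MvPolynomial (Fin K) ℂ)) (hV : IsVariety n I)
    (Q : Fin q → MvPolynomial (Fin K) ℂ) (d : Fin q → ℕ)
    (hd : ∀ j, 1 ≤ d j) (hQ : ∀ j, (Q j).IsHomogeneous (d j)) (R : Finset (Fin q)) :
    (0 : Fin K → ℂ) ∈ interCone I Q R := by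
  have hev : ∀ j, MvPolynomial.eval (0 : Fin K → ℂ) (Q j) = 0 := fun j =>
    eval_zero_of_homog (hQ j) (by have := hd j; omega)
  refine ⟨?_, by simpa only [hypCone, Set.mem_iInter, Set.mem_setOf_eq] using fun j _ => hev j⟩
  obtain ⟨hp, ⟨S, hS, rfl⟩, -⟩ := hV
  have : Ideal.span S ≤ MvPolynomial.vanishingIdeal ℂ {(0 : Fin K → ℂ)} := by
    rw [Ideal.span_le]
    intro g hg
    obtain ⟨e, he⟩ := hS g hg
    simp only [SetLike.mem_coe, MvPolynomial.mem_vanishingIdeal_singleton_iff,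
      MvPolynomial.aeval_eq_eval]
    by_contra hne
    rcases Nat.eq_zero_or_pos e with rfl | hpos
    · apply hp.ne_top
      have hC := MvPolynomial.totalDegree_eq_zero_iff_eq_C.1
        (Nat.le_zero.1 he.totalDegree_le)
      refine Ideal.eq_top_of_isUnit_mem _ (Ideal.subset_span hg) ?_
      rw [hC] at hne ⊢
      refine IsUnit.map _ (isUnit_iff_ne_zero.2 ?_)
      simpa using hne
    · exact hne (eval_zero_of_homog he (by omega))
  intro g hg
  have := this hg
  rwa [MvPolynomial.mem_vanishingIdeal_singleton_iff, MvPolynomial.aeval_eq_eval] at this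

lemma coneDim_spec {K q n : ℕ} (I : Ideal (MvPolynomial (Fin K) ℂ)) (hV : IsVariety n I)
    (Q : Fin q → MvPolynomial (Fin K) ℂ) (d : Fin q → ℕ)
    (hd : ∀ j, 1 ≤ d j) (hQ : ∀ j, (Q j).IsHomogeneous (d j)) (R : Finset (Fin q)) :
    ringKrullDim (MvPolynomial (Fin K) ℂ ⧸ jIdeal I Q R) =
      ((coneDim (interCone I Q R) : ℕ∞) : WithBot ℕ∞) ∧
    coneDim (interCone I Q R) ≤ n + 1 := by
  have h0 := zero_mem_interCone I hV Q d hd hQ R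
  have hle : ringKrullDim (MvPolynomial (Fin K) ℂ ⧸ jIdeal I Q R) ≤
      (((n + 1 : ℕ) : ℕ∞) : WithBot ℕ∞) := by
    rw [← hV.2.2]
    exact ringKrullDim_le_of_surjective (Ideal.Quotient.factor
      (le_sup_left : I ≤ jIdeal I Q R)) (Ideal.Quotient.factor_surjective _)
  have hne : jIdeal I Q R ≠ ⊤ := by
    intro h
    rw [interCone_eq, h, MvPolynomial.zeroLocus_top] at h0
    exact h0
  have : Nontrivial (MvPolynomial (Fin K) ℂ ⧸ jIdeal I Q R) :=
    Ideal.Quotient.nontrivial_iff.2 hne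
  have hge := ringKrullDim_nonneg_of_nontrivial (R := MvPolynomial (Fin K) ℂ ⧸ jIdeal I Q R)
  unfold coneDim
  rw [dim_vIdeal]
  generalize ringKrullDim (MvPolynomial (Fin K) ℂ ⧸ jIdeal I Q R) = D at *
  induction D with
  | bot => simp at hge
  | coe D =>
    induction D with
    | top => 
      norm_cast at hle
    | coe D =>
      refine ⟨rfl, ?_⟩
      have : D ≤ n + 1 := by exact_mod_cast hle
      simpa using this

lemma jIdeal_homog {K q n : ℕ} (I : Ideal (MvPolynomial (Fin K) ℂ)) (hV : IsVariety n I)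
    (Q : Fin q → MvPolynomial (Fin K) ℂ) (d : Fin q → ℕ)
    (hQ : ∀ j, (Q j).IsHomogeneous (d j)) (R : Finset (Fin q)) :
    (jIdeal I Q R).IsHomogeneous (MvPolynomial.homogeneousSubmodule (Fin K) ℂ) := by
  obtain ⟨hp, ⟨S, hS, rfl⟩, -⟩ := hV
  refine Ideal.IsHomogeneous.sup (Ideal.homogeneous_span _ _ ?_) (Ideal.homogeneous_span _ _ ?_)
  · intro g hg
    obtain ⟨e, he⟩ := hS g hg
    exact ⟨e, he⟩
  · rintro _ ⟨j, -, rfl⟩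
    exact ⟨d j, hQ j⟩

lemma coneDim_insert {K q n : ℕ} (I : Ideal (MvPolynomial (Fin K) ℂ)) (hV : IsVariety n I)
    (Q : Fin q → MvPolynomial (Fin K) ℂ) (d : Fin q → ℕ)
    (hd : ∀ j, 1 ≤ d j) (hQ : ∀ j, (Q j).IsHomogeneous (d j)) (R : Finset (Fin q)) (i : Fin q) :
    coneDim (interCone I Q R) ≤ coneDim (interCone I Q (insert i R)) + 1 := by
  have h := dim_homog (jIdeal I Q R) (jIdeal_homog I hV Q d hQ R) (Q i)
    (eval_zero_of_homog (hQ i) (by have := hd i; omega))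
  have he : jIdeal I Q R ⊔ Ideal.span {Q i} = jIdeal I Q (insert i R) := by
    simp only [jIdeal, Finset.coe_insert, Set.image_insert_eq]
    rw [Ideal.span_insert, sup_assoc, sup_comm (Ideal.span {Q i})]
  rw [he, (coneDim_spec I hV Q d hd hQ R).1, (coneDim_spec I hV Q d hd hQ (insert i R)).1] at h
  exact_mod_cast h

lemma cdim_mono {K q n : ℕ} (I : Ideal (MvPolynomial (Fin K) ℂ)) (hV : IsVariety n I)
    (Q : Fin q → MvPolynomial (Fin K) ℂ) (d : Fin q → ℕ)
    (hd : ∀ j, 1 ≤ d j) (hQ : ∀ j, (Q j).IsHomogeneous (d j)) (S T : Finset (Fin q))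
    (hST : S ⊆ T) :
    (S.card : ℤ) - (cdim n I Q S : ℤ) ≤ (T.card : ℤ) - (cdim n I Q T : ℤ) := by
  classical
  have key : ∀ U : Finset (Fin q), (S.card : ℤ) - (cdim n I Q S : ℤ) ≤
      ((S ∪ U).card : ℤ) - (cdim n I Q (S ∪ U) : ℤ) := by
    intro U
    induction U using Finset.induction_on with
    | empty => simp
    | insert i U hi ih =>
      rw [Finset.union_insert]
      by_cases hmem : i ∈ S ∪ U
      · rwa [Finset.insert_eq_of_mem hmem]
      · rw [Finset.card_insert_of_notMem hmem]
        have h1 := coneDim_insert I hV Q d hd hQ (S ∪ U) i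
        unfold cdim at ih ⊢
        omega
  have := key T
  rwa [Finset.union_eq_right.2 hST] at this

lemma coneDim_zero {K : ℕ} : coneDim ({0} : Set (Fin K → ℂ)) = 0 := by
  have h : vIdeal ({0} : Set (Fin K → ℂ)) = MvPolynomial.vanishingIdeal ℂ {(0 : Fin K → ℂ)} := by
    ext p
    simp only [MvPolynomial.mem_vanishingIdeal_iff, MvPolynomial.aeval_eq_eval]
    rfl
  have hm : (MvPolynomial.vanishingIdeal ℂ {(0 : Fin K → ℂ)}).IsMaximal := inferInstance
  unfold coneDim
  rw [h, ringKrullDim_eq_zero_of_isField ((Ideal.Quotient.maximal_ideal_iff_isField_quotient _).1 hm)]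
  simp

/-- **Lemma 2.3 (ii).** For `S₁ ⊆ S₂ ⊆ Q` one has `#S₁ - c(S₁) ≤ #S₂ - c(S₂)`; moreover
if `#S₂ ≤ N+1` then `#S₂ - c(S₂) ≤ N - n`. -/
theorem statement10 {M n N q : ℕ} (hn : 1 ≤ n) (hNn : n ≤ N) (hq : N + 1 ≤ q)
    (I : Ideal (MvPolynomial (Fin (M + 1)) ℂ)) (hV : IsSmoothVariety n I)
    (Q : Fin q → MvPolynomial (Fin (M + 1)) ℂ) (d : Fin q → ℕ)
    (hd : ∀ j, 1 ≤ d j) (hQ : ∀ j, (Q j).IsHomogeneous (d j))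
    (hsub : InSubgenPos n N I Q) :
    ∀ S₁ S₂ : Finset (Fin q), S₁ ⊆ S₂ →
      ((S₁.card : ℤ) - (cdim n I Q S₁ : ℤ) ≤ (S₂.card : ℤ) - (cdim n I Q S₂ : ℤ)) ∧
      (S₂.card ≤ N + 1 →
        (S₂.card : ℤ) - (cdim n I Q S₂ : ℤ) ≤ (N : ℤ) - (n : ℤ)) := by
  intro S₁ S₂ h12
  refine ⟨cdim_mono I hV.1 Q d hd hQ S₁ S₂ h12, fun hcard => ?_⟩
  obtain ⟨T, hT, hTc⟩ := Finset.exists_superset_card_eq hcard (by simpa using hq)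
  have h1 := cdim_mono I hV.1 Q d hd hQ S₂ T hT
  have h2 : interCone I Q T = {0} := by
    ext x
    refine ⟨fun hx => hsub.2.1 T hTc x hx, ?_⟩
    rintro rfl
    exact zero_mem_interCone I hV.1 Q d hd hQ T
  have h3 : cdim n I Q T = n + 1 := by
    rw [cdim, h2, coneDim_zero]
    rfl
  rw [h3, hTc] at h1
  push_cast at h1
  linarith

end SMT
end
end
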